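/- Every TAP instance in which every applicant's preference order is the restriction of a common master list of the schools (TAP-SM) admits exactly one stable matching. -/

import Mathlib

structure TAP (A : Type*) (S : Type*) (P : Type*) where
  ptype : A → Finset P
  prefA : A → List S
  cap : S → P → ℕ
  prefS : S → List A

namespace TAP

variable {A S P : Type*} [DecidableEq A] [DecidableEq S] [DecidableEq P] (J : TAP A S P)

def WellFormed : Prop :=
  (∀ a, (J.ptype a).card = 2) ∧ (∀ a, (J.prefA a).Nodup) ∧
  (∀ s, (J.prefS s).Nodup) ∧ (∀ a s, a ∈ J.prefS s ↔ s ∈ J.prefA a)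

def IsAssignment (M : Finset (A × S)) : Prop :=
  (∀ x ∈ M, x.2 ∈ J.prefA x.1) ∧
  ∀ a s s', (a, s) ∈ M → (a, s') ∈ M → s = s'

def Mp (M : Finset (A × S)) (s : S) (p : P) : Finset A :=
  (M.filter (fun x => x.2 = s ∧ p ∈ J.ptype x.1)).image Prod.fst

def Mpr (M : Finset (A × S)) (s : S) (p r : P) : Finset A :=
  (M.filter (fun x => x.2 = s ∧ J.ptype x.1 = {p, r})).image Prod.fst

def IsMatching (M : Finset (A × S)) : Prop :=
  J.IsAssignment M ∧ ∀ s p, (J.Mp M s p).card ≤ J.cap s p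

def Undersub (M : Finset (A × S)) (s : S) (p : P) : Prop :=
  (J.Mp M s p).card < J.cap s p

def PrefersA (a : A) (s s' : S) : Prop :=
  s ∈ J.prefA a ∧ s' ∈ J.prefA a ∧ (J.prefA a).idxOf s < (J.prefA a).idxOf s'

def PrefersS (s : S) (a a' : A) : Prop :=
  a ∈ J.prefS s ∧ a' ∈ J.prefS s ∧ (J.prefS s).idxOf a < (J.prefS s).idxOf a'

def Unassigned (M : Finset (A × S)) (a : A) : Prop := ∀ s, (a, s) ∉ M

def Blocks (M : Finset (A × S)) (a : A) (s : S) : Prop :=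
  s ∈ J.prefA a ∧
  (Unassigned M a ∨ ∃ s', (a, s') ∈ M ∧ J.PrefersA a s s') ∧
  ∃ p₁ p₂, p₁ ≠ p₂ ∧ J.ptype a = {p₁, p₂} ∧
    ((J.Undersub M s p₁ ∧ J.Undersub M s p₂) ∨
     (J.Undersub M s p₁ ∧ ∃ b ∈ J.Mp M s p₂, J.PrefersS s a b) ∨
     (J.Undersub M s p₂ ∧ ∃ b ∈ J.Mp M s p₁, J.PrefersS s a b) ∨
     (∃ b ∈ J.Mpr M s p₁ p₂, J.PrefersS s a b) ∨
     (∃ b₁ ∈ J.Mp M s p₁, ∃ b₂ ∈ J.Mp M s p₂, b₁ ≠ b₂ ∧ J.PrefersS s a b₁ ∧ J.PrefersS s a b₂))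

def Stable (M : Finset (A × S)) : Prop :=
  J.IsMatching M ∧ ∀ a s, ¬ J.Blocks M a s

end TAP
/-- A predicate that depends on a set only through the elements below the given point has exactly
one fixed point. -/
theorem existsUnique_finset_of_wellFounded {X : Type*} {r : X → X → Prop} (hr : WellFounded r)
    (U : Finset X) (Φ : Finset X → X → Prop) (hU : ∀ M x, Φ M x → x ∈ U)
    (hloc : ∀ M M' x, (∀ y, r y x → (y ∈ M ↔ y ∈ M')) → (Φ M x ↔ Φ M' x)) :
    ∃! M : Finset X, ∀ x, x ∈ M ↔ Φ M x := by
  classical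
  let R : X → Prop := hr.fix fun x ih => Φ (U.filter fun y => ∃ h : r y x, ih y h) x
  have hR : ∀ x, R x ↔ Φ (U.filter fun y => r y x ∧ R y) x := by
    intro x
    have h : R x = Φ (U.filter fun y => ∃ _ : r y x, R y) x := hr.fix_eq _ x
    rw [h]
    exact hloc _ _ _ fun y _ => by simp
  have hR' : ∀ x, R x ↔ Φ (U.filter R) x := by
    intro x
    rw [hR]
    refine hloc _ _ _ fun y hy => ?_
    simp [hy]
  refine ⟨U.filter R, fun x => ?_, fun M hM => ?_⟩
  · rw [← hR', Finset.mem_filter, and_iff_right_iff_imp]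
    exact fun h => hU _ _ ((hR' x).1 h)
  · ext x
    induction x using hr.induction with
    | _ x ih =>
      rw [hM, Finset.mem_filter, hR', hloc _ _ _ ih]
      exact ⟨fun h => ⟨hU _ _ h, h⟩, fun h => h.2⟩

theorem List.idxOf_filter_lt_idxOf_filter_iff {α : Type*} [DecidableEq α] (l : List α)
    (q : α → Bool) {x y : α} (hx : q x) (hy : q y) :
    (l.filter q).idxOf x < (l.filter q).idxOf y ↔ l.idxOf x < l.idxOf y := by
  induction l with
  | nil => simp
  | cons h t ih => grind

namespace TAP

theorem prefersA_iff {A S P : Type*} [DecidableEq S] {J : TAP A S P} {mls : List S}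
    (hmaster : ∀ a : A, J.prefA a = mls.filter (fun s => decide (s ∈ J.prefA a)))
    {a : A} {s s' : S} (hs : s ∈ J.prefA a) (hs' : s' ∈ J.prefA a) :
    J.PrefersA a s s' ↔ mls.idxOf s < mls.idxOf s' := by
  rw [← List.idxOf_filter_lt_idxOf_filter_iff mls (fun s => decide (s ∈ J.prefA a))
    (by simpa using hs) (by simpa using hs'), ← hmaster a]
  simp [PrefersA, hs, hs']

section

variable {A S P : Type*} [DecidableEq A] [DecidableEq S] [DecidableEq P] (J : TAP A S P)

theorem mem_Mp {M : Finset (A × S)} {s : S} {p : P} {a : A} :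
    a ∈ J.Mp M s p ↔ (a, s) ∈ M ∧ p ∈ J.ptype a := by
  simp only [Mp, Finset.mem_image, Finset.mem_filter, Prod.exists]
  aesop

theorem mem_Mpr {M : Finset (A × S)} {s : S} {p r : P} {a : A} :
    a ∈ J.Mpr M s p r ↔ (a, s) ∈ M ∧ J.ptype a = {p, r} := by
  simp only [Mpr, Finset.mem_image, Finset.mem_filter, Prod.exists]
  aesop

/-- The applicants assigned to `s` for subject `p` whom `s` ranks before `a`. -/
def betterMp (M : Finset (A × S)) (s : S) (p : P) (a : A) : Finset A :=
  (J.Mp M s p).filter fun b => (J.prefS s).idxOf b < (J.prefS s).idxOf a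

/-- The outcome of serial dictatorship: schools choose in the order of the master list, each taking
greedily, in its own order, the applicants still free. -/
def GreedyAt (mls : List S) (M : Finset (A × S)) (x : A × S) : Prop :=
  x.2 ∈ J.prefA x.1 ∧ (∀ s', mls.idxOf s' < mls.idxOf x.2 → (x.1, s') ∉ M) ∧
    ∀ p ∈ J.ptype x.1, (J.betterMp M x.2 p x.1).card < J.cap x.2 p

theorem existsUnique_greedy (hwf : J.WellFormed) (mls : List S) (hall : ∀ s : S, s ∈ mls) :
    ∃! M : Finset (A × S), ∀ x, x ∈ M ↔ J.GreedyAt mls M x := by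
  let rank : A × S → ℕ ×ₗ ℕ := fun x => toLex (mls.idxOf x.2, (J.prefS x.2).idxOf x.1)
  refine existsUnique_finset_of_wellFounded (r := InvImage (· < ·) rank)
    (InvImage.wf rank wellFounded_lt)
    (mls.toFinset.biUnion fun s => (J.prefS s).toFinset.image fun a => (a, s)) _ ?_ ?_
  · rintro M ⟨a, s⟩ ⟨h, -⟩
    simpa using ⟨hall s, (hwf.2.2.2 a s).2 h⟩
  · rintro M M' ⟨a, s⟩ h
    simp only [InvImage, rank, Prod.Lex.toLex_lt_toLex, Prod.forall] at h
    have hbetter : ∀ p, J.betterMp M s p a = J.betterMp M' s p a := by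
      intro p
      ext b
      simp only [betterMp, Finset.mem_filter, mem_Mp]
      have := h b s
      tauto
    simp only [GreedyAt, hbetter]
    refine and_congr_right fun _ => and_congr_left fun _ => forall₂_congr fun s' hs' => ?_
    rw [h a s' (Or.inl hs')]

variable {J}

theorem exists_prefersS_of_not_undersub (hwf : J.WellFormed) {M : Finset (A × S)}
    (hM : J.IsAssignment M) {a : A} {s : S} {p : P} (hs : s ∈ J.prefA a) (has : (a, s) ∉ M)
    (hlt : (J.betterMp M s p a).card < J.cap s p) (hu : ¬ J.Undersub M s p) :
    ∃ b ∈ J.Mp M s p, J.PrefersS s a b := by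
  obtain ⟨b, hb, hb'⟩ := Finset.exists_mem_notMem_of_card_lt_card
    (hlt.trans_le (not_lt.1 hu))
  have hbM := (J.mem_Mp.1 hb).1
  have hbs : b ∈ J.prefS s := (hwf.2.2.2 b s).2 (hM.1 _ hbM)
  have has' : a ∈ J.prefS s := (hwf.2.2.2 a s).2 hs
  refine ⟨b, hb, has', hbs, lt_of_le_of_ne ?_ fun h => ?_⟩
  · simpa [betterMp, hb] using hb'
  · rw [List.idxOf_inj has'] at h
    exact has (h ▸ hbM)

theorem Stable.greedyAt_iff (hwf : J.WellFormed) {mls : List S} (hall : ∀ s : S, s ∈ mls)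
    (hmaster : ∀ a : A, J.prefA a = mls.filter (fun s => decide (s ∈ J.prefA a)))
    {M : Finset (A × S)} (hM : J.Stable M) (x : A × S) : x ∈ M ↔ J.GreedyAt mls M x := by
  obtain ⟨⟨hA, hcap⟩, hblock⟩ := hM
  obtain ⟨a, s⟩ := x
  constructor
  · refine fun h => ⟨hA.1 _ h, fun s' hs' h' => ?_, fun p hp => ?_⟩
    · rw [hA.2 _ _ _ h h'] at hs'
      exact lt_irrefl _ hs'
    · refine lt_of_lt_of_le (Finset.card_lt_card ?_) (hcap s p)
      exact Finset.filter_ssubset.2 ⟨a, J.mem_Mp.2 ⟨h, hp⟩, lt_irrefl _⟩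
  · rintro ⟨hs, hfree, hlt⟩
    dsimp only at hs hfree hlt
    by_contra has
    refine hblock a s ⟨hs, ?_, ?_⟩
    · rw [or_iff_not_imp_left]
      intro hun
      obtain ⟨s', hs'⟩ : ∃ s', (a, s') ∈ M := by simpa [Unassigned] using hun
      refine ⟨s', hs', (prefersA_iff hmaster hs (hA.1 _ hs')).2 (lt_of_le_of_ne ?_ fun h => ?_)⟩
      · exact not_lt.1 fun h => hfree s' h hs'
      · rw [List.idxOf_inj (hall s)] at h
        exact has (h ▸ hs')
    · obtain ⟨p₁, p₂, hne, hp⟩ := Finset.card_eq_two.1 (hwf.1 a)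
      refine ⟨p₁, p₂, hne, hp, ?_⟩
      have h₁ := exists_prefersS_of_not_undersub hwf hA hs has (hlt p₁ (by simp [hp]))
      have h₂ := exists_prefersS_of_not_undersub hwf hA hs has (hlt p₂ (by simp [hp]))
      by_cases hu₁ : J.Undersub M s p₁
      · by_cases hu₂ : J.Undersub M s p₂
        · exact Or.inl ⟨hu₁, hu₂⟩
        · exact Or.inr (Or.inl ⟨hu₁, h₂ hu₂⟩)
      by_cases hu₂ : J.Undersub M s p₂
      · exact Or.inr (Or.inr (Or.inl ⟨hu₂, h₁ hu₁⟩))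
      obtain ⟨b₁, hb₁, hab₁⟩ := h₁ hu₁
      obtain ⟨b₂, hb₂, hab₂⟩ := h₂ hu₂
      refine Or.inr (Or.inr (Or.inr ?_))
      by_cases hb : b₁ = b₂
      · subst hb
        rw [mem_Mp] at hb₁ hb₂
        refine Or.inl ⟨b₁, J.mem_Mpr.2 ⟨hb₁.1, (Finset.eq_of_subset_of_card_le ?_ ?_).symm⟩, hab₁⟩
        · simp [Finset.insert_subset_iff, hb₁.2, hb₂.2]
        · rw [hwf.1, Finset.card_pair hne]
      · exact Or.inr ⟨b₁, hb₁, b₂, hb₂, hb, hab₁, hab₂⟩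

theorem isMatching_of_greedyAt (hwf : J.WellFormed) {mls : List S} (hall : ∀ s : S, s ∈ mls)
    {M : Finset (A × S)} (hM : ∀ x, x ∈ M ↔ J.GreedyAt mls M x) : J.IsMatching M := by
  have hpref : ∀ x ∈ M, x.2 ∈ J.prefA x.1 := fun x hx => ((hM x).1 hx).1
  refine ⟨⟨hpref, fun a s s' h h' => ?_⟩, fun s p => ?_⟩
  · rcases lt_trichotomy (mls.idxOf s) (mls.idxOf s') with hlt | heq | hlt
    · exact absurd h (((hM _).1 h').2.1 s hlt)
    · exact (List.idxOf_inj (hall s)).1 heq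
    · exact absurd h' (((hM _).1 h).2.1 s' hlt)
  · rcases (J.Mp M s p).eq_empty_or_nonempty with h | h
    · simp [h]
    obtain ⟨b, hb, hmax⟩ := Finset.exists_max_image _ (fun b => (J.prefS s).idxOf b) h
    have hb' := J.mem_Mp.1 hb
    have hsub : J.Mp M s p ⊆ insert b (J.betterMp M s p b) := by
      intro c hc
      rw [Finset.mem_insert, or_iff_not_imp_left]
      refine fun hcb => Finset.mem_filter.2 ⟨hc, lt_of_le_of_ne (hmax c hc) fun h => hcb ?_⟩
      exact (List.idxOf_inj ((hwf.2.2.2 c s).2 (hpref _ (J.mem_Mp.1 hc).1))).1 h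
    exact (Finset.card_le_card hsub).trans
      ((Finset.card_insert_le _ _).trans (((hM _).1 hb'.1).2.2 p hb'.2))

theorem stable_of_greedyAt (hwf : J.WellFormed) {mls : List S} (hall : ∀ s : S, s ∈ mls)
    (hmaster : ∀ a : A, J.prefA a = mls.filter (fun s => decide (s ∈ J.prefA a)))
    {M : Finset (A × S)} (hM : ∀ x, x ∈ M ↔ J.GreedyAt mls M x) : J.Stable M := by
  have hmatch := isMatching_of_greedyAt hwf hall hM
  refine ⟨hmatch, ?_⟩
  obtain ⟨hA, hcap⟩ := hmatch
  rintro a s ⟨hs, hfree, p₁, p₂, -, hp, hcase⟩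
  have hworse : ∀ s', (a, s') ∈ M → mls.idxOf s < mls.idxOf s' := by
    rintro s' hs'
    rcases hfree with hun | ⟨t, ht, hst⟩
    · exact absurd hs' (hun s')
    · rw [hA.2 _ _ _ hs' ht]
      exact (prefersA_iff hmaster hs (hA.1 _ ht)).1 hst
  have hfull : ∃ p ∈ J.ptype a, J.cap s p ≤ (J.betterMp M s p a).card := by
    by_contra! h
    exact lt_irrefl _ (hworse s ((hM (a, s)).2
      ⟨hs, fun s' hs' h' => lt_asymm hs' (hworse s' h'), h⟩))
  obtain ⟨p, hpa, hle⟩ := hfull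
  have heq : J.betterMp M s p a = J.Mp M s p :=
    Finset.eq_of_subset_of_card_le (Finset.filter_subset _ _) ((hcap s p).trans hle)
  have hu : ¬ J.Undersub M s p := by
    rw [Undersub, ← heq]
    exact not_lt.2 hle
  have hno : ∀ b ∈ J.Mp M s p, ¬ J.PrefersS s a b := by
    intro b hb hab
    rw [← heq] at hb
    exact lt_asymm (Finset.mem_filter.1 hb).2 hab.2.2
  have hMpr : ∀ b ∈ J.Mpr M s p₁ p₂, b ∈ J.Mp M s p := by
    intro b hb
    rw [mem_Mpr] at hb
    exact J.mem_Mp.2 ⟨hb.1, by rw [hb.2, ← hp]; exact hpa⟩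
  have hp' : p = p₁ ∨ p = p₂ := by simpa [hp] using hpa
  rcases hp' with rfl | rfl <;> grind

end

end TAP

theorem stmt5 {A S P : Type*} [DecidableEq A] [DecidableEq S] [DecidableEq P]
    (J : TAP A S P) (hwf : J.WellFormed) (mls : List S) (hnd : mls.Nodup)
    (hall : ∀ s : S, s ∈ mls)
    (hmaster : ∀ a : A, J.prefA a = mls.filter (fun s => decide (s ∈ J.prefA a))) :
    ∃! M : Finset (A × S), J.Stable M := by
  have h : ∀ M, J.Stable M ↔ ∀ x, x ∈ M ↔ J.GreedyAt mls M x := fun M =>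
    ⟨fun hM => hM.greedyAt_iff hwf hall hmaster, TAP.stable_of_greedyAt hwf hall hmaster⟩
  simpa only [h] using J.existsUnique_greedy hwf mls hall
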